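/- arXiv:0805.4367 — 6 statements merged into one kernel-verified Lean document; each statement's English description precedes it below -/
import Mathlib

section
/- Let Z be a metric space, let Φ : D_Φ ⊆ Z → Z and Ψ : D_Ψ ⊆ Z → Z be maps, and let R̃_1 = (R_1, R_1⁻) and R̃_2 = (R_2, R_2⁻) be oriented rectangles in Z. Suppose that: (H_Φ) there exist m_1 ≥ 1 pairwise disjoint compact sets H_1, …, H_{m_1} ⊆ R_1 ∩ D_Φ such that (H_i, Φ) stretches R̃_1 to R̃_2 along the paths for each i = 1, …, m_1; and (H_Ψ) there exist m_2 ≥ 1 pairwise disjoint compact sets K_1, …, K_{m_2} ⊆ R_2 ∩ D_Ψ such that (K_j, Ψ) stretches R̃_2 to R̃_1 along the paths for each j = 1, …, m_2. If m_1 · m_2 ≥ 2, then the composite map ψ := Ψ ∘ Φ induces chaotic dynamics on m_1 · m_2 symbols in the set H* = ⋃_{i,j} H'_{i,j}, relative to the m_1 · m_2 sets H'_{i,j} := H_i ∩ Φ^{−1}(K_j): the sets H'_{i,j} are pairwise disjoint nonempty compact sets, and for every two-sided sequence ((p_n, q_n))_{n∈ℤ} ∈ ({1,…,m_1} × {1,…,m_2})^ℤ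 there exists a two-sided sequence (w_n)_{n∈ℤ} with w_n ∈ H'_{p_n,q_n} and w_{n+1} = ψ(w_n) for all n ∈ ℤ, which can be chosen k-periodic whenever the symbol sequence is k-periodic. -/
/-- An oriented rectangle in a metric space `Z`: a homeomorphic copy of the unit square
`[0,1]²` (encoded by a map which is continuous and injective on the square — since the
square is compact and `Z` is Hausdorff, this is a homeomorphism onto its image),
together with the induced left/right (and down/up) sides. -/
structure OrientedRectangle (Z : Type*) [MetricSpace Z] where
  toFun : ℝ × ℝ → Z
  continuousOn : ContinuousOn toFun (Set.Icc (0 : ℝ) 1 ×ˢ Set.Icc (0 : ℝ) 1)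
  injOn : Set.InjOn toFun (Set.Icc (0 : ℝ) 1 ×ˢ Set.Icc (0 : ℝ) 1)

namespace OrientedRectangle

variable {Z : Type*} [MetricSpace Z] (R : OrientedRectangle Z)

/-- The generalized rectangle `R = h([0,1]²)`. -/
def carrier : Set Z := R.toFun '' (Set.Icc (0 : ℝ) 1 ×ˢ Set.Icc (0 : ℝ) 1)

/-- The left side `R⁻_left = h({0} × [0,1])`. -/
def left : Set Z := R.toFun '' (({0} : Set ℝ) ×ˢ Set.Icc (0 : ℝ) 1)

/-- The right side `R⁻_right = h({1} × [0,1])`. -/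
def right : Set Z := R.toFun '' (({1} : Set ℝ) ×ˢ Set.Icc (0 : ℝ) 1)

/-- The down side `R⁺_down = h([0,1] × {0})`. -/
def down : Set Z := R.toFun '' (Set.Icc (0 : ℝ) 1 ×ˢ ({0} : Set ℝ))

/-- The up side `R⁺_up = h([0,1] × {1})`. -/
def up : Set Z := R.toFun '' (Set.Icc (0 : ℝ) 1 ×ˢ ({1} : Set ℝ))

end OrientedRectangle

/-- `(K, ψ)` stretches the oriented rectangle `X` to the oriented rectangle `Y` along
the paths: `K ⊆ X` is compact, `ψ` is continuous on `K`, and every path in `X` joining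
the two components of `X⁻` admits a subpath lying in `K` which is mapped by `ψ` into `Y`
joining the two components of `Y⁻`. -/
def StretchesTo {Z : Type*} [MetricSpace Z] (K : Set Z) (ψ : Z → Z)
    (X Y : OrientedRectangle Z) : Prop :=
  IsCompact K ∧ K ⊆ X.carrier ∧ ContinuousOn ψ K ∧
  ∀ γ : ℝ → Z, ContinuousOn γ (Set.Icc (0 : ℝ) 1) →
    (∀ t ∈ Set.Icc (0 : ℝ) 1, γ t ∈ X.carrier) →
    ((γ 0 ∈ X.left ∧ γ 1 ∈ X.right) ∨ (γ 0 ∈ X.right ∧ γ 1 ∈ X.left)) →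
    ∃ t' t'' : ℝ, t' ∈ Set.Icc (0 : ℝ) 1 ∧ t'' ∈ Set.Icc (0 : ℝ) 1 ∧ t' ≤ t'' ∧
      (∀ t ∈ Set.Icc t' t'', γ t ∈ K ∧ ψ (γ t) ∈ Y.carrier) ∧
      ((ψ (γ t') ∈ Y.left ∧ ψ (γ t'') ∈ Y.right) ∨
        (ψ (γ t') ∈ Y.right ∧ ψ (γ t'') ∈ Y.left))


/-- The closed unit square. -/
def LTSq : Set (ℝ × ℝ) := Set.Icc (0 : ℝ) 1 ×ˢ Set.Icc (0 : ℝ) 1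

/-- A continuous angle which starts in `[-π/2, π/2]` and has nonnegative cosine stays there. -/
lemma lt_angle_stays {u : ℝ → ℝ} (hu : Continuous u)
    (hc : ∀ t ∈ Set.Icc (0 : ℝ) 1, 0 ≤ Real.cos (u t))
    (h0 : -(Real.pi / 2) ≤ u 0) (h0' : u 0 ≤ Real.pi / 2) :
    -(Real.pi / 2) ≤ u 1 ∧ u 1 ≤ Real.pi / 2 := by
  have key : ∀ v : ℝ → ℝ, Continuous v → (∀ t ∈ Set.Icc (0 : ℝ) 1, 0 ≤ Real.cos (v t)) →
      v 0 ≤ Real.pi / 2 → v 1 ≤ Real.pi / 2 := by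
    intro v hv hvc hv0
    by_contra! h
    have hpi := Real.pi_pos
    have hmem : min (v 1) Real.pi ∈ Set.Icc (v 0) (v 1) := by
      refine ⟨le_min (by linarith) (by linarith), min_le_left _ _⟩
    obtain ⟨t, ht, hte⟩ := intermediate_value_Icc zero_le_one hv.continuousOn hmem
    have h1 := hvc t ht
    rw [hte] at h1
    have h2 : Real.cos (min (v 1) Real.pi) < 0 := by
      apply Real.cos_neg_of_pi_div_two_lt_of_lt
      · exact lt_min h (by linarith)
      · exact lt_of_le_of_lt (min_le_right _ _) (by linarith)
    linarith
  refine ⟨?_, key u hu hc h0'⟩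
  have := key (fun t => - u t) hu.neg (fun t ht => by simpa using hc t ht) (by linarith)
  linarith

/-- The two dimensional Poincaré–Miranda theorem. -/
lemma lt_poincare_miranda {f g : ℝ × ℝ → ℝ} (hf : ContinuousOn f LTSq) (hg : ContinuousOn g LTSq)
    (hl : ∀ y ∈ Set.Icc (0 : ℝ) 1, 0 ≤ f (0, y)) (hr : ∀ y ∈ Set.Icc (0 : ℝ) 1, f (1, y) ≤ 0)
    (hb : ∀ x ∈ Set.Icc (0 : ℝ) 1, 0 ≤ g (x, 0)) (ht : ∀ x ∈ Set.Icc (0 : ℝ) 1, g (x, 1) ≤ 0) :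
    ∃ p ∈ LTSq, f p = 0 ∧ g p = 0 := by
  by_contra! hne
  let c : ℝ × ℝ → ℝ × ℝ := fun p => (max 0 (min 1 p.1), max 0 (min 1 p.2))
  have hcc : Continuous c := by fun_prop
  have hcm : ∀ p, c p ∈ LTSq := by
    intro p
    simp [c, LTSq]
  have hcid : ∀ p ∈ LTSq, c p = p := by
    rintro ⟨x, y⟩ ⟨⟨h1, h2⟩, h3, h4⟩
    simp only at h1 h2 h3 h4
    simp [c, h1, h2, h3, h4]
  let F : ℝ × ℝ → ℂ := fun p => ⟨f (c p), g (c p)⟩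
  have hF : Continuous F := by
    have h1 : Continuous fun p => f (c p) := hf.comp_continuous hcc hcm
    have h2 : Continuous fun p => g (c p) := hg.comp_continuous hcc hcm
    have : F = fun p => ((f (c p) : ℝ) : ℂ) + ((g (c p) : ℝ) : ℂ) * Complex.I := by
      ext p
      apply Complex.ext <;> simp [F]
    rw [this]
    exact (Complex.continuous_ofReal.comp h1).add
      ((Complex.continuous_ofReal.comp h2).mul continuous_const)
  have hF0 : ∀ p, F p ≠ 0 := by
    intro p h
    have h1 := congrArg Complex.re h
    have h2 := congrArg Complex.im h
    exact hne _ (hcm p) h1 h2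
  have hsc : IsSimplyConnected (Set.univ : Set (ℝ × ℝ)) := by
    have : ContractibleSpace (Set.univ : Set (ℝ × ℝ)) :=
      (convex_univ (𝕜 := ℝ)).contractibleSpace Set.univ_nonempty
    unfold IsSimplyConnected
    infer_instance
  obtain ⟨L, hL, hexp⟩ := Complex.exists_continuousOn_eqOn_exp_comp hsc isOpen_univ
    hF.continuousOn (by rintro ⟨p, -, hp⟩; exact hF0 p hp)
  rw [continuousOn_univ] at hL
  have hexp' : ∀ p, Complex.exp (L p) = F p := fun p => hexp (Set.mem_univ p)
  have hre : ∀ p ∈ LTSq, f p = Real.exp (L p).re * Real.cos (L p).im := by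
    intro p hp
    have := congrArg Complex.re (hexp' p)
    rw [Complex.exp_re] at this
    simp only [F, hcid p hp] at this
    exact this.symm
  have him : ∀ p ∈ LTSq, g p = Real.exp (L p).re * Real.sin (L p).im := by
    intro p hp
    have := congrArg Complex.im (hexp' p)
    rw [Complex.exp_im] at this
    simp only [F, hcid p hp] at this
    exact this.symm
  obtain ⟨n, hn⟩ : ∃ n : ℤ, (L (0,0)).im - n * (2 * Real.pi) ∈ Set.Ioc (-Real.pi) Real.pi := by
    refine ⟨toIocDiv Real.two_pi_pos (-Real.pi) (L (0,0)).im, ?_⟩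
    have := sub_toIocDiv_zsmul_mem_Ioc Real.two_pi_pos (-Real.pi) (L (0,0)).im
    rw [zsmul_eq_mul] at this
    have e : -Real.pi + 2 * Real.pi = Real.pi := by ring
    rwa [e] at this
  let θ : ℝ × ℝ → ℝ := fun p => (L p).im - n * (2 * Real.pi)
  have hθ : Continuous θ := by fun_prop
  have hcos : ∀ p, Real.cos (θ p) = Real.cos (L p).im := fun p => Real.cos_sub_int_mul_two_pi _ _
  have hsin : ∀ p, Real.sin (θ p) = Real.sin (L p).im := fun p => Real.sin_sub_int_mul_two_pi _ _
  have m : ∀ x ∈ Set.Icc (0:ℝ) 1, ∀ y ∈ Set.Icc (0:ℝ) 1, (x, y) ∈ LTSq := fun x hx y hy => ⟨hx, hy⟩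
  have i0 : (0:ℝ) ∈ Set.Icc (0:ℝ) 1 := by simp
  have i1 : (1:ℝ) ∈ Set.Icc (0:ℝ) 1 := by simp
  have cl : ∀ y ∈ Set.Icc (0 : ℝ) 1, 0 ≤ Real.cos (θ (0, y)) := by
    intro y hy
    have := hl y hy
    rw [hre _ (m _ i0 _ hy), ← hcos] at this
    exact nonneg_of_mul_nonneg_right this (Real.exp_pos _)
  have cr : ∀ y ∈ Set.Icc (0 : ℝ) 1, Real.cos (θ (1, y)) ≤ 0 := by
    intro y hy
    have := hr y hy
    rw [hre _ (m _ i1 _ hy), ← hcos] at this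
    exact nonpos_of_mul_nonpos_right this (Real.exp_pos _)
  have cb : ∀ x ∈ Set.Icc (0 : ℝ) 1, 0 ≤ Real.sin (θ (x, 0)) := by
    intro x hx
    have := hb x hx
    rw [him _ (m _ hx _ i0), ← hsin] at this
    exact nonneg_of_mul_nonneg_right this (Real.exp_pos _)
  have ct : ∀ x ∈ Set.Icc (0 : ℝ) 1, Real.sin (θ (x, 1)) ≤ 0 := by
    intro x hx
    have := ht x hx
    rw [him _ (m _ hx _ i1), ← hsin] at this
    exact nonpos_of_mul_nonpos_right this (Real.exp_pos _)
  have hpi := Real.pi_pos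
  have a1 : -Real.pi < θ (0,0) := hn.1
  have a2 : θ (0,0) ≤ Real.pi := hn.2
  have a3 : 0 ≤ θ (0,0) := by
    by_contra! h
    have := Real.sin_neg_of_neg_of_neg_pi_lt h a1
    have := cb 0 i0
    linarith
  have a4 : θ (0,0) ≤ Real.pi / 2 := by
    by_contra! h
    have := Real.cos_neg_of_pi_div_two_lt_of_lt h (by linarith)
    have := cl 0 i0
    linarith
  have b1 := lt_angle_stays (u := fun t => θ (0, t)) (by fun_prop) cl (by linarith) a4
  have b2 := lt_angle_stays (u := fun t => θ (t, 0) - Real.pi / 2) (by fun_prop)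
    (fun t ht => by rw [Real.cos_sub_pi_div_two]; exact cb t ht) (by linarith) (by linarith)
  have b2' : Real.pi / 2 ≤ θ (1, 0) := by
    by_contra! h
    have := Real.cos_pos_of_mem_Ioo (x := θ (1, 0)) ⟨by linarith [b2.1], h⟩
    have := cr 0 i0
    linarith
  have b3 := lt_angle_stays (u := fun t => θ (1, t) - Real.pi) (by fun_prop)
    (fun t ht => by rw [Real.cos_sub_pi]; linarith [cr t ht]) (by linarith) (by linarith [b2.2])
  have b3' : Real.pi ≤ θ (1, 1) := by
    by_contra! h
    have := Real.sin_pos_of_pos_of_lt_pi (x := θ (1, 1)) (by linarith [b3.1]) h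
    have := ct 1 i1
    linarith
  have b4 := lt_angle_stays (u := fun t => θ (1 - t, 1) - Real.pi - Real.pi / 2) (by fun_prop)
    (fun t ht => by
      rw [Real.cos_sub_pi_div_two, Real.sin_sub_pi]
      linarith [ct (1 - t) ⟨by linarith [ht.2], by linarith [ht.1]⟩])
    (by simp only [sub_zero]; linarith) (by simp only [sub_zero]; linarith [b3.2])
  simp only [sub_self] at b4
  linarith [b4.1, b1.2]

/-- If a compact subset `S` of the square meets every left-right path, and splits into
two compact parts (one away from the top, one away from the bottom), these parts meet. -/
lemma lt_crossing {S T : Set (ℝ × ℝ)} (hS : IsClosed S) (hT : IsClosed T)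
    (hSt : ∀ x, (x, (1 : ℝ)) ∉ S) (hTb : ∀ x, (x, (0 : ℝ)) ∉ T)
    (hpath : ∀ γ : ℝ → ℝ × ℝ, Continuous γ → (∀ t ∈ Set.Icc (0 : ℝ) 1, γ t ∈ LTSq) →
      (γ 0).1 = 0 → (γ 1).1 = 1 → ∃ t ∈ Set.Icc (0 : ℝ) 1, γ t ∈ S ∪ T) :
    (S ∩ T).Nonempty := by
  classical
  by_contra! hdis
  have hdis' : ∀ p, p ∈ S → p ∈ T → False := fun p h1 h2 => by
    have : p ∈ S ∩ T := ⟨h1, h2⟩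
    simp [hdis] at this
  have hST : IsClosed (S ∪ T) := hS.union hT
  have hne : (S ∪ T).Nonempty := by
    obtain ⟨t, -, h⟩ := hpath (fun t => (t, 0)) (by fun_prop)
      (fun t ht => ⟨ht, by simp⟩) rfl rfl
    exact ⟨_, h⟩
  let U : Set (ℝ × ℝ) := {x | ∃ a : ℝ × ℝ, a.1 = 0 ∧ JoinedIn (LTSq \ (S ∪ T)) a x}
  let d : ℝ × ℝ → ℝ := fun x => Metric.infDist x (S ∪ T)
  have hd : Continuous d := Metric.continuous_infDist_pt _
  have hd0 : ∀ x, x ∈ S ∪ T → d x = 0 := fun x hx => Metric.infDist_zero_of_mem hx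
  have hdpos : ∀ x, x ∉ S ∪ T → 0 < d x := fun x hx =>
    (hST.notMem_iff_infDist_pos hne).1 hx
  let f : ℝ × ℝ → ℝ := fun x => if x ∈ U then d x else - d x
  have habs : ∀ x, |f x| = d x := by
    intro x
    have : 0 ≤ d x := Metric.infDist_nonneg
    by_cases h : x ∈ U <;> simp [f, h, abs_of_nonneg this]
  have hsqc : Convex ℝ LTSq := (convex_Icc 0 1).prod (convex_Icc 0 1)
  have hloc : ∀ x ∈ LTSq, ∀ y ∈ LTSq, dist y x < d x → (y ∈ U ↔ x ∈ U) := by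
    intro x hx y hy hxy
    have hj : JoinedIn (LTSq \ (S ∪ T)) x y := by
      apply JoinedIn.of_segment_subset
      intro z hz
      refine ⟨hsqc.segment_subset hx hy hz, fun hzS => ?_⟩
      have h1 : z ∈ Metric.ball x (d x) :=
        (convex_ball x (d x)).segment_subset
          (Metric.mem_ball_self (lt_of_le_of_lt dist_nonneg hxy)) hxy hz
      have h2 : d x ≤ dist x z := Metric.infDist_le_dist_of_mem hzS
      rw [Metric.mem_ball, dist_comm] at h1
      linarith
    constructor
    · rintro ⟨a, ha, h⟩
      exact ⟨a, ha, h.trans hj.symm⟩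
    · rintro ⟨a, ha, h⟩
      exact ⟨a, ha, h.trans hj⟩
  have hf : ContinuousOn f LTSq := by
    intro x hx
    by_cases hxS : x ∈ S ∪ T
    · have hfx : f x = 0 := by
        rw [← abs_eq_zero, habs, hd0 x hxS]
      unfold ContinuousWithinAt
      rw [hfx]
      apply squeeze_zero_norm (a := d) (fun y => (habs y).le)
      have := hd.tendsto x
      rw [hd0 x hxS] at this
      exact this.mono_left nhdsWithin_le_nhds
    · have hev : ∀ᶠ y in nhdsWithin x LTSq, (y ∈ U ↔ x ∈ U) := by
        have h1 : ∀ᶠ y in nhdsWithin x LTSq, y ∈ Metric.ball x (d x) :=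
          nhdsWithin_le_nhds (Metric.ball_mem_nhds x (hdpos x hxS))
        filter_upwards [h1, self_mem_nhdsWithin] with y hy1 hy2
        exact hloc x hx y hy2 hy1
      by_cases hxU : x ∈ U
      · refine (hd.continuousWithinAt).congr_of_eventuallyEq ?_ (by simp [f, hxU])
        filter_upwards [hev] with y hy
        simp [f, hy, hxU]
      · refine (hd.neg.continuousWithinAt).congr_of_eventuallyEq ?_ (by simp [f, hxU])
        filter_upwards [hev] with y hy
        simp [f, hy, hxU]
  let A : Set (ℝ × ℝ) := S ∪ {p | p.2 = 0}
  let B : Set (ℝ × ℝ) := T ∪ {p | p.2 = 1}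
  have hA : IsClosed A := hS.union (isClosed_eq continuous_snd continuous_const)
  have hB : IsClosed B := hT.union (isClosed_eq continuous_snd continuous_const)
  have hAn : A.Nonempty := ⟨(0, 0), Or.inr rfl⟩
  have hBn : B.Nonempty := ⟨(0, 1), Or.inr rfl⟩
  obtain ⟨p, hp, hfp, hgp⟩ := lt_poincare_miranda (f := f)
    (g := fun x => Metric.infDist x B - Metric.infDist x A) hf
    ((Metric.continuous_infDist_pt _).sub (Metric.continuous_infDist_pt _)).continuousOn
    (fun y hy => by
      by_cases h : ((0 : ℝ), y) ∈ S ∪ T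
      · have : f (0, y) = 0 := by rw [← abs_eq_zero, habs, hd0 _ h]
        exact this.ge
      · have hU : ((0 : ℝ), y) ∈ U := ⟨(0, y), rfl, JoinedIn.refl ⟨⟨by simp, hy⟩, h⟩⟩
        simp only [f, hU, if_true]
        exact Metric.infDist_nonneg)
    (fun y hy => by
      have hU : ((1 : ℝ), y) ∉ U := by
        rintro ⟨a, ha, γ, hγ⟩
        obtain ⟨t, ht, h⟩ := hpath γ.extend γ.continuous_extend
          (fun t ht => by rw [γ.extend_apply ht]; exact (hγ _).1)
          (by rw [γ.extend_zero]; exact ha) (by rw [γ.extend_one])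
        rw [γ.extend_apply ht] at h
        exact (hγ _).2 h
      simp only [f, hU, if_false]
      have : 0 ≤ d (1, y) := Metric.infDist_nonneg
      linarith)
    (fun x hx => by
      have : Metric.infDist (x, (0 : ℝ)) A = 0 := Metric.infDist_zero_of_mem (Or.inr rfl)
      rw [this, sub_zero]
      exact Metric.infDist_nonneg)
    (fun x hx => by
      have : Metric.infDist (x, (1 : ℝ)) B = 0 := Metric.infDist_zero_of_mem (Or.inr rfl)
      rw [this, zero_sub]
      exact neg_nonpos.2 Metric.infDist_nonneg)
  have hpS : p ∈ S ∪ T := by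
    by_contra h
    have := hdpos p h
    rw [← habs, hfp] at this
    simp at this
  rcases hpS with h | h
  · have h1 : p ∉ B := by
      rintro (h2 | h2)
      · exact hdis' p h h2
      · obtain ⟨x, y⟩ := p
        simp only [Set.mem_ofPred_eq] at h2
        subst h2
        exact hSt x h
    have h2 := (hB.notMem_iff_infDist_pos hBn).1 h1
    have h3 : Metric.infDist p A = 0 := Metric.infDist_zero_of_mem (Or.inl h)
    linarith
  · have h1 : p ∉ A := by
      rintro (h2 | h2)
      · exact hdis' p h2 h
      · obtain ⟨x, y⟩ := p
        simp only [Set.mem_ofPred_eq] at h2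
        subst h2
        exact hTb x h
    have h2 := (hA.notMem_iff_infDist_pos hAn).1 h1
    have h3 : Metric.infDist p B = 0 := Metric.infDist_zero_of_mem (Or.inl h)
    linarith

/-- Planar fixed point theorem for maps stretching along the paths. -/
lemma lt_planar_fixed {K : Set (ℝ × ℝ)} {g : ℝ × ℝ → ℝ × ℝ} (hK : IsClosed K) 
    (hg : ContinuousOn g K) (hgm : ∀ p ∈ K, g p ∈ LTSq)
    (hpath : ∀ γ : ℝ → ℝ × ℝ, Continuous γ → (∀ t ∈ Set.Icc (0 : ℝ) 1, γ t ∈ LTSq) →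
      (γ 0).1 = 0 → (γ 1).1 = 1 → ∃ t' t'' : ℝ, t' ∈ Set.Icc (0 : ℝ) 1 ∧ t'' ∈ Set.Icc (0 : ℝ) 1 ∧
        t' ≤ t'' ∧ (∀ t ∈ Set.Icc t' t'', γ t ∈ K) ∧
        (((g (γ t')).1 = 0 ∧ (g (γ t'')).1 = 1) ∨ ((g (γ t')).1 = 1 ∧ (g (γ t'')).1 = 0))) :
    ∃ p ∈ K, g p = p := by
  by_contra! hnf
  have hg1 : ContinuousOn (fun p => (g p).1) K := continuous_fst.comp_continuousOn hg
  have hg2 : ContinuousOn (fun p => (g p).2) K := continuous_snd.comp_continuousOn hg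
  let D : Set (ℝ × ℝ) := K ∩ (fun p => (g p).1 - p.1) ⁻¹' {0}
  have hD : IsClosed D :=
    (hg1.sub continuous_fst.continuousOn).preimage_isClosed_of_isClosed hK isClosed_singleton
  have hDK : D ⊆ K := Set.inter_subset_left
  have hdc : ContinuousOn (fun p => (g p).2 - p.2) D :=
    (hg2.sub continuous_snd.continuousOn).mono hDK
  let S : Set (ℝ × ℝ) := D ∩ (fun p => (g p).2 - p.2) ⁻¹' (Set.Ici 0)
  let T : Set (ℝ × ℝ) := D ∩ (fun p => (g p).2 - p.2) ⁻¹' (Set.Iic 0)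
  have hS : IsClosed S := hdc.preimage_isClosed_of_isClosed hD isClosed_Ici
  have hT : IsClosed T := hdc.preimage_isClosed_of_isClosed hD isClosed_Iic
  have hfix : ∀ p ∈ D, (g p).2 - p.2 = 0 → False := by
    intro p hp h
    have h1 : (g p).1 - p.1 = 0 := hp.2
    exact hnf p (hDK hp) (Prod.ext (by linarith) (by linarith))
  obtain ⟨p, hpS, hpT⟩ := lt_crossing hS hT
    (fun x hx => by
      have h1 : 0 ≤ (g (x, 1)).2 - 1 := hx.2
      have h2 := (hgm _ (hDK hx.1)).2.2
      exact hfix _ hx.1 (by simp only; linarith))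
    (fun x hx => by
      have h1 : (g (x, 0)).2 - 0 ≤ 0 := hx.2
      have h2 := (hgm _ (hDK hx.1)).2.1
      exact hfix _ hx.1 (by simp only; linarith))
    (fun γ hγ hm h0 h1 => by
      obtain ⟨t', t'', ht', ht'', hle, hin, hends⟩ := hpath γ hγ hm h0 h1
      have hc : ContinuousOn (fun t => (g (γ t)).1 - (γ t).1) (Set.Icc t' t'') :=
        (hg1.comp hγ.continuousOn hin).sub (continuous_fst.comp hγ).continuousOn
      have e1 := (hm t' ht').1
      have e2 := (hm t'' ht'').1
      obtain ⟨t, ht, hz⟩ : ∃ t ∈ Set.Icc t' t'', (g (γ t)).1 - (γ t).1 = 0 := by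
        rcases hends with ⟨h3, h4⟩ | ⟨h3, h4⟩
        · exact intermediate_value_Icc hle hc ⟨by simp only [h3]; linarith [e1.1],
            by simp only [h4]; linarith [e2.2]⟩
        · exact intermediate_value_Icc' hle hc ⟨by simp only [h4]; linarith [e2.1],
            by simp only [h3]; linarith [e1.2]⟩
      refine ⟨t, ⟨ht'.1.trans ht.1, ht.2.trans ht''.2⟩, ?_⟩
      have hDt : γ t ∈ D := ⟨hin t ht, hz⟩
      rcases le_total 0 ((g (γ t)).2 - (γ t).2) with h | h
      · exact Or.inl ⟨hDt, h⟩
      · exact Or.inr ⟨hDt, h⟩)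
  have h1 : 0 ≤ (g p).2 - p.2 := hpS.2
  have h2 : (g p).2 - p.2 ≤ 0 := hpT.2
  exact hfix p hpS.1 (le_antisymm h2 h1)

section LinkedTwistAux

variable {Z : Type*} [MetricSpace Z]

lemma lt_sq_compact : IsCompact LTSq := isCompact_Icc.prod isCompact_Icc

lemma lt_carrier_compact (X : OrientedRectangle Z) : IsCompact X.carrier :=
  lt_sq_compact.image_of_continuousOn X.continuousOn

lemma lt_left_sub (X : OrientedRectangle Z) : X.left ⊆ X.carrier := by
  apply Set.image_mono
  rintro ⟨x, y⟩ ⟨h1, h2⟩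
  simp only [Set.mem_singleton_iff] at h1
  subst h1
  exact ⟨by simp, h2⟩

lemma lt_right_sub (X : OrientedRectangle Z) : X.right ⊆ X.carrier := by
  apply Set.image_mono
  rintro ⟨x, y⟩ ⟨h1, h2⟩
  simp only [Set.mem_singleton_iff] at h1
  subst h1
  exact ⟨by simp, h2⟩

lemma lt_left_coord (X : OrientedRectangle Z) {p : ℝ × ℝ} (hp : p ∈ LTSq)
    (h : X.toFun p ∈ X.left) : p.1 = 0 := by
  obtain ⟨q, ⟨hq1, hq2⟩, hq⟩ := h
  simp only [Set.mem_singleton_iff] at hq1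
  have := X.injOn (show q ∈ LTSq from ⟨by simp [hq1], hq2⟩) hp hq
  rw [← this, hq1]

lemma lt_right_coord (X : OrientedRectangle Z) {p : ℝ × ℝ} (hp : p ∈ LTSq)
    (h : X.toFun p ∈ X.right) : p.1 = 1 := by
  obtain ⟨q, ⟨hq1, hq2⟩, hq⟩ := h
  simp only [Set.mem_singleton_iff] at hq1
  have := X.injOn (show q ∈ LTSq from ⟨by simp [hq1], hq2⟩) hp hq
  rw [← this, hq1]

lemma lt_left_mem (X : OrientedRectangle Z) {p : ℝ × ℝ} (hp : p ∈ LTSq)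
    (h : p.1 = 0) : X.toFun p ∈ X.left := ⟨p, ⟨h, hp.2⟩, rfl⟩

lemma lt_right_mem (X : OrientedRectangle Z) {p : ℝ × ℝ} (hp : p ∈ LTSq)
    (h : p.1 = 1) : X.toFun p ∈ X.right := ⟨p, ⟨h, hp.2⟩, rfl⟩

/-- Fixed points of maps stretching a rectangle to itself. -/
lemma lt_fixed {X : OrientedRectangle Z} {K : Set Z} {ψ : Z → Z} (h : StretchesTo K ψ X X) :
    ∃ x ∈ K, ψ x = x := by
  obtain ⟨hK, hKX, hψ, hst⟩ := h
  let K₁ : Set (ℝ × ℝ) := LTSq ∩ X.toFun ⁻¹' K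
  have hK₁ : IsClosed K₁ :=
    X.continuousOn.preimage_isClosed_of_isClosed lt_sq_compact.isClosed hK.isClosed
  have hψh : ContinuousOn (fun p => ψ (X.toFun p)) K₁ :=
    hψ.comp (X.continuousOn.mono Set.inter_subset_left) (fun p hp => hp.2)
  let K' : Set (ℝ × ℝ) := K₁ ∩ (fun p => ψ (X.toFun p)) ⁻¹' X.carrier
  have hK' : IsClosed K' :=
    hψh.preimage_isClosed_of_isClosed hK₁ (lt_carrier_compact X).isClosed
  let g : ℝ × ℝ → ℝ × ℝ := fun p => Function.invFunOn X.toFun LTSq (ψ (X.toFun p))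
  have hgm : ∀ p ∈ K', g p ∈ LTSq := fun p hp => Function.invFunOn_mem hp.2
  have hgh : ∀ p ∈ K', X.toFun (g p) = ψ (X.toFun p) := fun p hp => Function.invFunOn_eq hp.2
  have hgc : ContinuousOn g K' := by
    have : CompactSpace LTSq := isCompact_iff_compactSpace.1 lt_sq_compact
    have hX : ContinuousOn X.toFun LTSq := X.continuousOn
    have hXc : Continuous (fun q : LTSq => X.toFun q) :=
      continuousOn_iff_continuous_domRestrict.1 hX
    have hXi : Function.Injective (fun q : LTSq => X.toFun q) :=
      fun p q hpq => Subtype.ext (X.injOn p.2 q.2 hpq)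
    have hemb : Topology.IsClosedEmbedding (fun q : LTSq => X.toFun q) :=
      hXc.isClosedEmbedding hXi
    have hc : Continuous (fun p : K' => (⟨g p, hgm p p.2⟩ : LTSq)) := by
      rw [hemb.isEmbedding.isInducing.continuous_iff]
      have h1 := continuousOn_iff_continuous_domRestrict.1 (hψh.mono Set.inter_subset_left : ContinuousOn _ K')
      convert h1 using 1
      ext p
      exact hgh p p.2
    rw [continuousOn_iff_continuous_domRestrict]
    exact continuous_subtype_val.comp hc
  obtain ⟨p, hp, hfp⟩ := lt_planar_fixed hK' hgc hgm (by
    intro γ hγ hm h0 h1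
    have i0 : (0:ℝ) ∈ Set.Icc (0:ℝ) 1 := by simp
    have i1 : (1:ℝ) ∈ Set.Icc (0:ℝ) 1 := by simp
    obtain ⟨t', t'', ht', ht'', hle, hin, hends⟩ := hst (fun t => X.toFun (γ t))
      (X.continuousOn.comp hγ.continuousOn hm) (fun t ht => ⟨γ t, hm t ht, rfl⟩)
      (Or.inl ⟨lt_left_mem X (hm 0 i0) h0, lt_right_mem X (hm 1 i1) h1⟩)
    have hin' : ∀ t ∈ Set.Icc t' t'', γ t ∈ K' := fun t ht =>
      ⟨⟨hm t ⟨ht'.1.trans ht.1, ht.2.trans ht''.2⟩, (hin t ht).1⟩, (hin t ht).2⟩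
    have j' := hin' t' ⟨le_rfl, hle⟩
    have j'' := hin' t'' ⟨hle, le_rfl⟩
    refine ⟨t', t'', ht', ht'', hle, hin', ?_⟩
    simp only [← hgh _ j', ← hgh _ j''] at hends
    rcases hends with ⟨h3, h4⟩ | ⟨h3, h4⟩
    · exact Or.inl ⟨lt_left_coord X (hgm _ j') h3, lt_right_coord X (hgm _ j'') h4⟩
    · exact Or.inr ⟨lt_right_coord X (hgm _ j') h3, lt_left_coord X (hgm _ j'') h4⟩)
  refine ⟨X.toFun p, hp.1.2, ?_⟩
  rw [← hgh p hp, hfp]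

lemma lt_stretch_id (X : OrientedRectangle Z) : StretchesTo X.carrier id X X := by
  refine ⟨lt_carrier_compact X, le_rfl, continuousOn_id, fun γ _ hm hends => ?_⟩
  exact ⟨0, 1, by simp, by simp, zero_le_one, fun t ht => ⟨hm t ht, hm t ht⟩, hends⟩

lemma lt_stretch_comp {X Y W : OrientedRectangle Z} {A B : Set Z} {f g : Z → Z}
    (hf : StretchesTo A f X Y) (hg : StretchesTo B g Y W) :
    StretchesTo (A ∩ f ⁻¹' B) (fun x => g (f x)) X W := by
  obtain ⟨hA, hAX, hfc, hfs⟩ := hf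
  obtain ⟨hB, hBY, hgc, hgs⟩ := hg
  refine ⟨hA.of_isClosed_subset
    (hfc.preimage_isClosed_of_isClosed hA.isClosed hB.isClosed) Set.inter_subset_left,
    fun x hx => hAX hx.1,
    hgc.comp (hfc.mono Set.inter_subset_left) (fun x hx => hx.2), fun γ hγ hm hends => ?_⟩
  obtain ⟨a, b, ha, hb, hab, hin, he⟩ := hfs γ hγ hm hends
  let r : ℝ → ℝ := fun t => a + t * (b - a)
  have hba : 0 ≤ b - a := by linarith
  have hr : ∀ t ∈ Set.Icc (0 : ℝ) 1, r t ∈ Set.Icc a b := by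
    intro t ht
    constructor
    · have := mul_nonneg ht.1 hba
      simp only [r]; linarith
    · have := mul_le_mul_of_nonneg_right ht.2 hba
      simp only [r]; linarith
  have hrc : Continuous r := by fun_prop
  have hab' : Set.Icc a b ⊆ Set.Icc (0 : ℝ) 1 := Set.Icc_subset_Icc ha.1 hb.2
  have r0 : r 0 = a := by simp [r]
  have r1 : r 1 = b := by simp [r]
  have hγr : ContinuousOn (fun t => γ (r t)) (Set.Icc 0 1) :=
    hγ.comp hrc.continuousOn (fun t ht => hab' (hr t ht))
  obtain ⟨c, d, hc, hd, hcd, hin2, he2⟩ := hgs (fun t => f (γ (r t)))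
    (hfc.comp hγr (fun t ht => (hin _ (hr t ht)).1)) (fun t ht => (hin _ (hr t ht)).2)
    (by simpa only [r0, r1] using he)
  have hrcd : r c ≤ r d := by
    have := mul_le_mul_of_nonneg_right hcd hba
    simp only [r]; linarith
  refine ⟨r c, r d, hab' (hr c hc), hab' (hr d hd), hrcd, ?_, he2⟩
  intro t ht
  obtain ⟨s, hs, rfl⟩ := intermediate_value_Icc hcd hrc.continuousOn ht
  have hs' : s ∈ Set.Icc (0 : ℝ) 1 := ⟨hc.1.trans hs.1, hs.2.trans hd.2⟩
  exact ⟨⟨(hin _ (hr s hs')).1, (hin2 s hs).1⟩, (hin2 s hs).2⟩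

/-- A stretching pair has a nonempty domain. -/
lemma lt_stretch_nonempty {X Y : OrientedRectangle Z} {A : Set Z} {f : Z → Z}
    (hf : StretchesTo A f X Y) : A.Nonempty := by
  have hm : ∀ t ∈ Set.Icc (0:ℝ) 1, (t, (0:ℝ)) ∈ LTSq := fun t ht => ⟨ht, by simp⟩
  obtain ⟨a, b, _, _, hab, hin, _⟩ := hf.2.2.2 (fun t => X.toFun (t, 0))
    (X.continuousOn.comp (by fun_prop) hm) (fun t ht => ⟨_, hm t ht, rfl⟩)
    (Or.inl ⟨lt_left_mem X (hm 0 (by simp)) rfl, lt_right_mem X (hm 1 (by simp)) rfl⟩)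
  exact ⟨_, (hin a ⟨le_rfl, hab⟩).1⟩

lemma lt_stretch_iter {X : OrientedRectangle Z} {f : Z → Z} (A : ℕ → Set Z)
    (hA : ∀ n, StretchesTo (A n) f X X) (n : ℕ) :
    StretchesTo {x | x ∈ X.carrier ∧ ∀ i < n, f^[i] x ∈ A i} (f^[n]) X X := by
  induction n with
  | zero => simpa using lt_stretch_id X
  | succ n ih =>
    have h := lt_stretch_comp ih (hA n)
    have e1 : (fun x => f (f^[n] x)) = f^[n + 1] := by
      ext x
      rw [Function.iterate_succ_apply']
    rw [e1] at h
    convert h using 1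
    ext x
    simp only [Set.mem_ofPred_eq, Set.mem_inter_iff, Set.mem_preimage, Nat.lt_succ_iff_lt_or_eq]
    constructor
    · rintro ⟨h1, h2⟩
      exact ⟨⟨h1, fun i hi => h2 i (Or.inl hi)⟩, h2 n (Or.inr rfl)⟩
    · rintro ⟨⟨h1, h2⟩, h3⟩
      refine ⟨h1, fun i hi => ?_⟩
      rcases hi with hi | rfl
      · exact h2 i hi
      · exact h3

/-- Periodic itineraries are realized by periodic orbits. -/
lemma lt_periodic {X : OrientedRectangle Z} {f : Z → Z} (A : ℤ → Set Z)
    (hA : ∀ n, StretchesTo (A n) f X X) (k : ℕ) (hk : 1 ≤ k) (hper : ∀ n, A (n + (k : ℤ)) = A n) :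
    ∃ w : ℤ → Z, (∀ n, w n ∈ A n) ∧ (∀ n, w (n + 1) = f (w n)) ∧ ∀ n, w (n + (k : ℤ)) = w n := by
  obtain ⟨x, ⟨-, hx⟩, hfx⟩ := lt_fixed (lt_stretch_iter (fun n => A n) (fun n => hA n) k)
  have hk0 : (0 : ℤ) < k := by exact_mod_cast hk
  have hmod : ∀ n : ℤ, A (n % k) = A n := by
    intro n
    have hp : Function.Periodic A (k : ℤ) := hper
    have h1 := hp.sub_zsmul_eq (x := n) (n / k)
    rw [← h1]
    congr 1
    rw [smul_eq_mul, Int.emod_def, mul_comm]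
  refine ⟨fun n => f^[(n % k).toNat] x, fun n => ?_, fun n => ?_, fun n => ?_⟩
  · have h0 := Int.emod_nonneg n hk0.ne'
    have h1 := Int.emod_lt_of_pos n hk0
    have := hx (n % k).toNat (by omega)
    rw [Int.toNat_of_nonneg h0, hmod] at this
    exact this
  · have h0 := Int.emod_nonneg n hk0.ne'
    have h1 := Int.emod_lt_of_pos n hk0
    simp only
    rw [← Function.iterate_succ_apply' f]
    rcases lt_or_ge (n % k + 1) k with h | h
    · have : (n + 1) % (k : ℤ) = n % k + 1 := by
        rw [← Int.emod_add_emod]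
        exact Int.emod_eq_of_lt (by omega) h
      rw [this]
      congr 2
      omega
    · have h2 : n % k + 1 = k := by omega
      have : (n + 1) % (k : ℤ) = 0 := by
        rw [← Int.emod_add_emod, h2, Int.emod_self]
      rw [this]
      have h3 : (n % k).toNat.succ = k := by omega
      rw [h3, hfx]
      rfl
  · simp

/-- Every itinerary is realized. -/
lemma lt_itinerary {X : OrientedRectangle Z} {f : Z → Z} (A : ℤ → Set Z)
    (hA : ∀ n, StretchesTo (A n) f X X) :
    ∃ w : ℤ → Z, (∀ n, w n ∈ A n) ∧ ∀ n, w (n + 1) = f (w n) := by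
  let P : Set (ℤ → Z) := Set.univ.pi A
  have hP : IsCompact P := isCompact_univ_pi fun n => (hA n).1
  let E : ℤ → Set (ℤ → Z) := fun n => {w | w ∈ P ∧ w (n + 1) = f (w n)}
  have hE : ∀ n, IsClosed (E n) := by
    intro n
    have h1 : ContinuousOn (fun w : ℤ → Z => (w (n + 1), f (w n))) P :=
      (continuous_apply (n + 1)).continuousOn.prodMk
        ((hA n).2.2.1.comp (continuous_apply n).continuousOn (fun w hw => hw n (Set.mem_univ n)))
    exact h1.preimage_isClosed_of_isClosed hP.isClosed isClosed_diagonal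
  let t : ℕ → Set (ℤ → Z) := fun N => P ∩ ⋂ n ∈ Set.Ico (-(N : ℤ)) N, E n
  have hcl : ∀ N, IsClosed (t N) := fun N =>
    hP.isClosed.inter (isClosed_biInter fun n _ => hE n)
  obtain ⟨w, hw⟩ := IsCompact.nonempty_iInter_of_sequence_nonempty_isCompact_isClosed t
    (by
      intro N w hw
      refine ⟨hw.1, ?_⟩
      have h2 := hw.2
      simp only [Set.mem_iInter] at h2 ⊢
      intro n hn
      exact h2 n ⟨by have := hn.1; push_cast; linarith, by have := hn.2; push_cast; linarith⟩)
    (by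
      intro N
      obtain ⟨x, -, hx⟩ := lt_stretch_nonempty (lt_stretch_iter (fun n => A (n - N))
        (fun n => hA _) (2 * N + 1))
      choose z hz using fun n => lt_stretch_nonempty (hA n)
      let w : ℤ → Z := fun n => if n ∈ Set.Icc (-(N : ℤ)) N then f^[(n + N).toNat] x else z n
      have hw : w ∈ P := by
        intro n _
        by_cases hn : n ∈ Set.Icc (-(N : ℤ)) N
        · simp only [w, hn, if_true]
          have h1 := hn.1
          have h2 := hn.2
          have h3 := hx (n + N).toNat (by omega)
          have h4 : (((n + N).toNat : ℕ) : ℤ) - N = n := by omega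
          rwa [h4] at h3
        · simp only [w, hn, if_false]
          exact hz n
      refine ⟨w, hw, ?_⟩
      simp only [Set.mem_iInter]
      intro n hn
      refine ⟨hw, ?_⟩
      have h1 := hn.1
      have h2 := hn.2
      have m1 : n ∈ Set.Icc (-(N : ℤ)) N := ⟨h1, h2.le⟩
      have m2 : n + 1 ∈ Set.Icc (-(N : ℤ)) N := ⟨by omega, by omega⟩
      simp only [w, m1, m2, if_true]
      rw [← Function.iterate_succ_apply' f]
      congr 2
      omega)
    (hP.of_isClosed_subset (hcl 0) Set.inter_subset_left) hcl
  rw [Set.mem_iInter] at hw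
  refine ⟨w, fun n => (hw 0).1 n (Set.mem_univ n), fun n => ?_⟩
  have h := (hw (n.natAbs + 1)).2
  simp only [Set.mem_iInter] at h
  exact (h n ⟨by omega, by omega⟩).2

end LinkedTwistAux

/-- the linked-twist-maps lemma. If `m₁ ≥ 1` pairwise disjoint compact sets
`H i ⊆ R₁` stretch `R₁` to `R₂` under `Φ`, and `m₂ ≥ 1` pairwise disjoint compact sets
`K j ⊆ R₂` stretch `R₂` to `R₁` under `Ψ`, and `m₁ m₂ ≥ 2`, then `ψ = Ψ ∘ Φ` induces
chaotic dynamics on `m₁ × m₂` symbols relatively to the sets `H' (i,j) = H i ∩ Φ⁻¹(K j)`: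
these are nonempty pairwise disjoint compact sets, every two-sided sequence of symbols is
realized by an orbit of `ψ` with the prescribed itinerary, and periodic symbol sequences
are realized by periodic orbits. -/
theorem linked_twist_chaos {Z : Type*} [MetricSpace Z] (Φ Ψ : Z → Z)
    (R₁ R₂ : OrientedRectangle Z) (m₁ m₂ : ℕ) (hm₁ : 1 ≤ m₁) (hm₂ : 1 ≤ m₂)
    (H : Fin m₁ → Set Z) (K : Fin m₂ → Set Z)
    (hHd : Pairwise fun i j => Disjoint (H i) (H j))
    (hKd : Pairwise fun i j => Disjoint (K i) (K j))
    (hH : ∀ i, StretchesTo (H i) Φ R₁ R₂)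
    (hK : ∀ j, StretchesTo (K j) Ψ R₂ R₁)
    (hm : 2 ≤ m₁ * m₂) :
    (∀ p : Fin m₁ × Fin m₂,
      (H p.1 ∩ Φ ⁻¹' (K p.2)).Nonempty ∧ IsCompact (H p.1 ∩ Φ ⁻¹' (K p.2))) ∧
    (Pairwise fun p q : Fin m₁ × Fin m₂ =>
      Disjoint (H p.1 ∩ Φ ⁻¹' (K p.2)) (H q.1 ∩ Φ ⁻¹' (K q.2))) ∧
    (∀ s : ℤ → Fin m₁ × Fin m₂,
      ∃ w : ℤ → Z, (∀ n, w n ∈ H (s n).1 ∩ Φ ⁻¹' (K (s n).2)) ∧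
        ∀ n, w (n + 1) = Ψ (Φ (w n))) ∧
    ∀ (s : ℤ → Fin m₁ × Fin m₂) (k : ℕ), 1 ≤ k → (∀ n, s (n + (k : ℤ)) = s n) →
      ∃ w : ℤ → Z, (∀ n, w n ∈ H (s n).1 ∩ Φ ⁻¹' (K (s n).2)) ∧
        (∀ n, w (n + 1) = Ψ (Φ (w n))) ∧ ∀ n, w (n + (k : ℤ)) = w n := by

  have hA : ∀ p : Fin m₁ × Fin m₂,
      StretchesTo (H p.1 ∩ Φ ⁻¹' (K p.2)) (fun x => Ψ (Φ x)) R₁ R₁ :=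
    fun p => lt_stretch_comp (hH p.1) (hK p.2)
  refine ⟨fun p => ⟨lt_stretch_nonempty (hA p), (hA p).1⟩, ?_, ?_, ?_⟩
  · intro p q hpq
    rw [Set.disjoint_left]
    rintro x ⟨h1, h2⟩ ⟨h3, h4⟩
    apply hpq
    apply Prod.ext
    · by_contra h
      exact Set.disjoint_left.1 (hHd h) h1 h3
    · by_contra h
      exact Set.disjoint_left.1 (hKd h) h2 h4
  · intro s
    exact lt_itinerary (fun n => H (s n).1 ∩ Φ ⁻¹' (K (s n).2)) (fun n => hA (s n))
  · intro s k hk hs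
    exact lt_periodic (fun n => H (s n).1 ∩ Φ ⁻¹' (K (s n).2)) (fun n => hA (s n)) k hk
      (fun n => by simp only [hs n])
end

section
/- Let (Z, d_Z) be a metric space and let ψ : D_ψ ⊆ Z → Z induce chaotic dynamics on m ≥ 2 symbols in a set D ⊆ D_ψ relative to pairwise disjoint nonempty compact sets K_1, …, K_m. Assume ψ is continuous and injective on K := K_1 ∪ ⋯ ∪ K_m. Define I := { w ∈ K : there exists a two-sided sequence (w_i)_{i∈ℤ} of points of K with w_0 = w and ψ(w_i) = w_{i+1} for all i ∈ ℤ }. Then: (i) I is a nonempty compact set with ψ(I) = I; (ii) there exists a continuous surjection g : I → Σ_m = {1,…,m}^ℤ such that g ∘ (ψ|_I) = σ ∘ g, where σ is the Bernoulli shift σ((s_i)_i) = (s_{i+1})_i; (iii) for every k ≥ 1 and every k-periodic sequence s ∈ Σ_m (s_{i+k} = s_i for all i), the preimage g^{−1}(s) contains at least one point w ∈ I with ψ^k(w) = w. -/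
/-- semiconjugation to the Bernoulli shift. Suppose `ψ` induces chaotic
dynamics on `m ≥ 2` symbols in `D` relatively to the pairwise disjoint nonempty compact
sets `K j`, and `ψ` is continuous and injective on `K = ⋃ j, K j`. Let
`I = { w : ∃ two-sided orbit (wᵢ) in K with w₀ = w }`. Then `I` is a nonempty compact
invariant set, `ψ|_I` is semiconjugate to the two-sided shift on `Σ_m = {1,…,m}^ℤ`
through a continuous surjection `g`, and every `k`-periodic sequence has a `k`-periodic
point of `ψ` in its `g`-preimage. -/
theorem chaotic_dynamics_semiconj {Z : Type*} [MetricSpace Z]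
    (ψ : Z → Z) (D : Set Z) (m : ℕ) (hm : 2 ≤ m)
    (K : Fin m → Set Z)
    (hKD : ∀ j, K j ⊆ D)
    (hKne : ∀ j, (K j).Nonempty) (hKc : ∀ j, IsCompact (K j))
    (hKd : Pairwise fun i j => Disjoint (K i) (K j))
    (hchaos : ∀ s : ℤ → Fin m, ∃ w : ℤ → Z,
      (∀ i, w i ∈ K (s i)) ∧ ∀ i, w (i + 1) = ψ (w i))
    (hper : ∀ (s : ℤ → Fin m) (k : ℕ), 1 ≤ k → (∀ i, s (i + (k : ℤ)) = s i) →
      ∃ w : ℤ → Z, (∀ i, w i ∈ K (s i)) ∧ (∀ i, w (i + 1) = ψ (w i)) ∧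
        ∀ i, w (i + (k : ℤ)) = w i)
    (hcont : ContinuousOn ψ (⋃ j, K j)) (hinj : Set.InjOn ψ (⋃ j, K j))
    (I : Set Z)
    (hI : I = {w : Z | ∃ ws : ℤ → Z, ws 0 = w ∧ (∀ i, ws i ∈ ⋃ j, K j) ∧
      ∀ i, ψ (ws i) = ws (i + 1)}) :
    I.Nonempty ∧ IsCompact I ∧ ψ '' I = I ∧
    ∃ g : Z → (ℤ → Fin m),
      ContinuousOn g I ∧ g '' I = Set.univ ∧
      (∀ w ∈ I, g (ψ w) = fun i => g w (i + 1)) ∧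
      ∀ (s : ℤ → Fin m) (k : ℕ), 1 ≤ k → (∀ i, s (i + (k : ℤ)) = s i) →
        ∃ w ∈ I, g w = s ∧ ψ^[k] w = w := by
  classical
  have hne : Nonempty (Fin m) := ⟨⟨0, by omega⟩⟩
  set U : Set Z := ⋃ j, K j with hU
  have hUc : IsCompact U := isCompact_iUnion hKc
  have hsub : ∀ j, K j ⊆ U := fun j => Set.subset_iUnion K j
  let O : Set (ℤ → Z) := {ws | (∀ i, ws i ∈ U) ∧ ∀ i, ψ (ws i) = ws (i + 1)}
  have hI_eq : I = (fun ws : ℤ → Z => ws 0) '' O := by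
    rw [hI]
    ext w
    constructor
    · rintro ⟨ws, h0, h1, h2⟩
      exact ⟨ws, ⟨h1, h2⟩, h0⟩
    · rintro ⟨ws, ⟨h1, h2⟩, h0⟩
      exact ⟨ws, h0, h1, h2⟩
  have hPc : IsCompact (Set.pi Set.univ (fun _ : ℤ => U)) := isCompact_univ_pi fun _ => hUc
  have hOc : IsCompact O := by
    have hO : O = ⋂ i : ℤ, (Set.pi Set.univ (fun _ : ℤ => U) ∩
        (fun ws : ℤ → Z => (ψ (ws i), ws (i + 1))) ⁻¹' Set.diagonal Z) := by
      ext ws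
      simp only [O, Set.mem_iInter, Set.mem_inter_iff, Set.mem_pi, Set.mem_univ, true_imp_iff,
        Set.mem_preimage, Set.mem_diagonal_iff, Set.mem_ofPred_eq]
      exact ⟨fun h i => ⟨h.1, h.2 i⟩, fun h => ⟨(h 0).1, fun i => (h i).2⟩⟩
    refine hPc.of_isClosed_subset ?_ ?_
    · rw [hO]
      refine isClosed_iInter fun i => ?_
      refine ContinuousOn.preimage_isClosed_of_isClosed ?_ hPc.isClosed isClosed_diagonal
      refine ContinuousOn.prodMk ?_ (continuous_apply (i + 1)).continuousOn
      exact hcont.comp (continuous_apply i).continuousOn (fun ws h => h i (Set.mem_univ i))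
    · intro ws h i _
      exact h.1 i
  have huniq : ∀ ws ∈ O, ∀ vs ∈ O, ws 0 = vs 0 → ws = vs := by
    intro ws hw vs hv h0
    funext i
    induction i using Int.induction_on with
    | zero => exact h0
    | succ n ih => rw [← hw.2, ← hv.2, ih]
    | pred n ih =>
      apply hinj (hw.1 _) (hv.1 _)
      rw [hw.2, hv.2]
      simpa using ih
  have hsym : ∃ sym : Z → Fin m, ∀ j, ∀ z ∈ K j, sym z = j := by
    refine ⟨fun z => if h : ∃ j, z ∈ K j then h.choose else Classical.choice hne, ?_⟩
    intro j z hz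
    have h : ∃ j, z ∈ K j := ⟨j, hz⟩
    simp only [dif_pos h]
    by_contra hcon
    exact Set.disjoint_left.1 (hKd hcon) h.choose_spec hz
  obtain ⟨sym, hsym⟩ := hsym
  have horb : ∃ orb : Z → ℤ → Z, ∀ ws ∈ O, orb (ws 0) = ws := by
    refine ⟨fun z => if h : ∃ ws ∈ O, ws 0 = z then h.choose else fun _ => z, ?_⟩
    intro ws hw
    have h : ∃ vs ∈ O, vs 0 = ws 0 := ⟨ws, hw, rfl⟩
    simp only [dif_pos h]
    exact huniq _ h.choose_spec.1 _ hw h.choose_spec.2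
  obtain ⟨orb, horb⟩ := horb
  have hshift : ∀ ws ∈ O, ∀ n : ℤ, (fun i => ws (i + n)) ∈ O := by
    intro ws hw n
    refine ⟨fun i => hw.1 _, fun i => ?_⟩
    simp only [hw.2]
    congr 1
    ring
  have hg : ∀ ws ∈ O, ∀ s : ℤ → Fin m, (∀ i, ws i ∈ K (s i)) →
      (fun i => sym (orb (ws 0) i)) = s := by
    intro ws hw s hs
    funext i
    rw [horb ws hw]
    exact hsym _ _ (hs i)
  have hmk : ∀ (w : ℤ → Z) (s : ℤ → Fin m), (∀ i, w i ∈ K (s i)) →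
      (∀ i, w (i + 1) = ψ (w i)) → w ∈ O :=
    fun w s h1 h2 => ⟨fun i => hsub _ (h1 i), fun i => (h2 i).symm⟩
  have hI0 : ∀ ws ∈ O, ws 0 ∈ I := fun ws hw => hI_eq ▸ ⟨ws, hw, rfl⟩
  refine ⟨?_, ?_, ?_, fun w i => sym (orb w i), ?_, ?_, ?_, ?_⟩
  · obtain ⟨w, h1, h2⟩ := hchaos (fun _ => Classical.choice hne)
    exact ⟨_, hI0 w (hmk w _ h1 h2)⟩
  · rw [hI_eq]
    exact hOc.image (continuous_apply 0)
  · ext z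
    constructor
    · rintro ⟨w, hw, rfl⟩
      rw [hI_eq] at hw
      obtain ⟨ws, hws, rfl⟩ := hw
      have := hI0 _ (hshift ws hws 1)
      simpa only [hws.2] using this
    · intro hz
      rw [hI_eq] at hz
      obtain ⟨ws, hws, rfl⟩ := hz
      refine ⟨_, hI0 _ (hshift ws hws (-1)), ?_⟩
      simp [hws.2]
  · rw [continuousOn_pi]
    intro i
    rw [continuousOn_iff_isClosed]
    intro t _
    have hcl : IsClosed (⋃ j ∈ t, K j) :=
      (Set.toFinite t).isClosed_biUnion fun j _ => (hKc j).isClosed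
    refine ⟨(fun ws : ℤ → Z => ws 0) '' (O ∩ (fun ws : ℤ → Z => ws i) ⁻¹' (⋃ j ∈ t, K j)),
      ((hOc.inter_right (hcl.preimage (continuous_apply i))).image
        (continuous_apply 0)).isClosed, ?_⟩
    ext z
    constructor
    · rintro ⟨h1, h2⟩
      refine ⟨?_, h2⟩
      rw [hI_eq] at h2
      obtain ⟨ws, hws, rfl⟩ := h2
      refine ⟨ws, ⟨hws, ?_⟩, rfl⟩
      simp only [Set.mem_preimage, horb ws hws] at h1
      obtain ⟨j, hj⟩ := Set.mem_iUnion.1 (hws.1 i)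
      rw [hsym j _ hj] at h1
      exact Set.mem_biUnion h1 hj
    · rintro ⟨⟨ws, ⟨hws, hi⟩, rfl⟩, h2⟩
      refine ⟨?_, h2⟩
      simp only [Set.mem_preimage, Set.mem_iUnion] at hi
      obtain ⟨j, hjt, hj⟩ := hi
      simp only [Set.mem_preimage, horb ws hws]
      rw [hsym j _ hj]
      exact hjt
  · refine Set.eq_univ_of_forall fun s => ?_
    obtain ⟨w, h1, h2⟩ := hchaos s
    have hw := hmk w s h1 h2
    exact ⟨w 0, hI0 w hw, hg w hw s h1⟩
  · intro w hw
    rw [hI_eq] at hw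
    obtain ⟨ws, hws, rfl⟩ := hw
    have h := horb _ (hshift ws hws 1)
    simp only [zero_add] at h
    have h3 : ψ (ws 0) = ws 1 := by simpa using hws.2 0
    funext i
    simp only [h3, h, horb ws hws]
  · intro s k hk hs
    obtain ⟨w, h1, h2, h3⟩ := hper s k hk hs
    have hw := hmk w s h1 h2
    refine ⟨w 0, hI0 w hw, hg w hw s h1, ?_⟩
    have hit : ∀ n : ℕ, ψ^[n] (w 0) = w n := by
      intro n
      induction n with
      | zero => simp
      | succ n ih => rw [Function.iterate_succ_apply', ih, ← h2]; simp
    rw [hit]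
    simpa using h3 0
end

section
/- Let (Z, d_Z) be a metric space and let ψ : D_ψ ⊆ Z → Z induce chaotic dynamics on m ≥ 2 symbols in a set D ⊆ D_ψ relative to pairwise disjoint nonempty compact sets K_1, …, K_m, with ψ continuous and injective on K := K_1 ∪ ⋯ ∪ K_m. Let I := { w ∈ K : there exists a two-sided sequence (w_i)_{i∈ℤ} in K with w_0 = w and ψ(w_i) = w_{i+1} for all i }, and let g : I → Σ_m be the coding map sending w to the sequence (s_i)_{i∈ℤ} with ψ^i-orbit entries lying in K_{s_i}. Define Λ as the closure of the set P := { w ∈ I : ψ^k(w) = w for some k ≥ 1 } of periodic points of ψ|_I. Then Λ is a compact set with ψ(Λ) = Λ, the restriction g|_Λ : Λ → Σ_m is a continuous surjection satisfying g ∘ (ψ|_Λ) = σ ∘ g, the periodic points of ψ|_I are dense in Λ, and for every k-periodic sequence s ∈ Σ_m the preimage g^{−1}(s) contains at least one point w ∈ Λ with ψ^k(w) = w. -/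
/-- the closure `Λ` of the set `P` of periodic points of `ψ|_I` is a compact
invariant set on which the coding map `g` restricts to a continuous surjection onto
`Σ_m = {1,…,m}^ℤ` semiconjugating `ψ|_Λ` with the Bernoulli shift; the periodic points
of `ψ|_I` are dense in `Λ` and every `k`-periodic sequence is the code of some
`k`-periodic point in `Λ`. Here `g` is the itinerary map: for `w ∈ I`, the two-sided
orbit of `w` through `K = ⋃ j, K j` lies in the sets `K (g w i)`. -/
theorem chaotic_dynamics_periodic_closure {Z : Type*} [MetricSpace Z]
    (ψ : Z → Z) (D : Set Z) (m : ℕ) (hm : 2 ≤ m)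
    (K : Fin m → Set Z)
    (hKD : ∀ j, K j ⊆ D)
    (hKne : ∀ j, (K j).Nonempty) (hKc : ∀ j, IsCompact (K j))
    (hKd : Pairwise fun i j => Disjoint (K i) (K j))
    (hchaos : ∀ s : ℤ → Fin m, ∃ w : ℤ → Z,
      (∀ i, w i ∈ K (s i)) ∧ ∀ i, w (i + 1) = ψ (w i))
    (hper : ∀ (s : ℤ → Fin m) (k : ℕ), 1 ≤ k → (∀ i, s (i + (k : ℤ)) = s i) →
      ∃ w : ℤ → Z, (∀ i, w i ∈ K (s i)) ∧ (∀ i, w (i + 1) = ψ (w i)) ∧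
        ∀ i, w (i + (k : ℤ)) = w i)
    (hcont : ContinuousOn ψ (⋃ j, K j)) (hinj : Set.InjOn ψ (⋃ j, K j))
    (I : Set Z)
    (hI : I = {w : Z | ∃ ws : ℤ → Z, ws 0 = w ∧ (∀ i, ws i ∈ ⋃ j, K j) ∧
      ∀ i, ψ (ws i) = ws (i + 1)})
    (g : Z → (ℤ → Fin m))
    (hg : ∀ w ∈ I, ∀ ws : ℤ → Z, ws 0 = w → (∀ i, ws i ∈ ⋃ j, K j) →
      (∀ i, ψ (ws i) = ws (i + 1)) → ∀ i, ws i ∈ K (g w i))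
    (P : Set Z) (hP : P = {w ∈ I | ∃ k : ℕ, 1 ≤ k ∧ ψ^[k] w = w})
    (Λ : Set Z) (hΛ : Λ = closure P) :
    IsCompact Λ ∧ ψ '' Λ = Λ ∧
    ContinuousOn g Λ ∧ g '' Λ = Set.univ ∧
    (∀ w ∈ Λ, g (ψ w) = fun i => g w (i + 1)) ∧
    (∀ w ∈ Λ, w ∈ closure P) ∧
    ∀ (s : ℤ → Fin m) (k : ℕ), 1 ≤ k → (∀ i, s (i + (k : ℤ)) = s i) →
      ∃ w ∈ Λ, g w = s ∧ ψ^[k] w = w := by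
  have hKKc : IsCompact (⋃ j, K j) := isCompact_iUnion hKc
  -- itineraries are determined by any full orbit
  have key : ∀ (ws : ℤ → Z) (s : ℤ → Fin m), (∀ i, ws i ∈ K (s i)) →
      (∀ i, ws (i + 1) = ψ (ws i)) → ws 0 ∈ I ∧ g (ws 0) = s := by
    intro ws s h1 h2
    have hK : ∀ i, ws i ∈ ⋃ j, K j := fun i => Set.mem_iUnion.2 ⟨s i, h1 i⟩
    have h0 : ws 0 ∈ I := by
      rw [hI]
      exact ⟨ws, rfl, hK, fun i => (h2 i).symm⟩
    refine ⟨h0, ?_⟩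
    funext i
    by_contra hne
    exact Set.disjoint_left.1 (hKd hne) (hg _ h0 ws rfl hK (fun i => (h2 i).symm) i) (h1 i)
  have orb : ∀ w ∈ I, ∃ ws : ℤ → Z, ws 0 = w ∧ (∀ i, ws i ∈ K (g w i)) ∧
      (∀ i, ws (i + 1) = ψ (ws i)) := by
    intro w hw
    have hw' := hw
    rw [hI] at hw'
    obtain ⟨ws, h0, h1, h2⟩ := hw'
    exact ⟨ws, h0, hg w hw ws h0 h1 h2, fun i => (h2 i).symm⟩
  have shift : ∀ w ∈ I, ψ w ∈ I ∧ g (ψ w) = fun i => g w (i + 1) := by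
    intro w hw
    obtain ⟨ws, h0, h1, h2⟩ := orb w hw
    have := key (fun i => ws (i + 1)) (fun i => g w (i + 1)) (fun i => h1 _) (fun i => h2 _)
    simp only [h2 0, h0] at this
    exact this
  -- the compact space of full orbits
  let W : Set (ℤ → Z) := {ws | (∀ i, ws i ∈ ⋃ j, K j) ∧ ∀ i, ψ (ws i) = ws (i + 1)}
  have hWc : IsCompact W := by
    have hpi : IsCompact (Set.pi Set.univ fun _ : ℤ => ⋃ j, K j) :=
      isCompact_univ_pi fun _ => hKKc
    refine hpi.of_isClosed_subset ?_ (fun ws h i _ => h.1 i)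
    have : W = ⋂ i : ℤ, (Set.pi Set.univ fun _ : ℤ => ⋃ j, K j) ∩
        (fun ws : ℤ → Z => (ψ (ws i), ws (i + 1))) ⁻¹' (Set.diagonal Z) := by
      ext ws
      simp only [W, Set.mem_setOf_eq, Set.mem_iInter, Set.mem_inter_iff, Set.mem_pi,
        Set.mem_univ, true_imp_iff, Set.mem_preimage, Set.mem_diagonal_iff]
      exact ⟨fun h i => ⟨h.1, h.2 i⟩, fun h => ⟨(h 0).1, fun i => (h i).2⟩⟩
    rw [this]
    refine isClosed_iInter fun i => ?_
    refine ContinuousOn.preimage_isClosed_of_isClosed ?_ hpi.isClosed isClosed_diagonal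
    refine ContinuousOn.prodMk ?_ (continuous_apply _).continuousOn
    exact hcont.comp (continuous_apply i).continuousOn (fun ws h => h i trivial)
  have hIW : I = (fun ws : ℤ → Z => ws 0) '' W := by
    rw [hI]
    ext w
    constructor
    · rintro ⟨ws, h0, h1, h2⟩
      exact ⟨ws, ⟨h1, h2⟩, h0⟩
    · rintro ⟨ws, ⟨h1, h2⟩, h0⟩
      exact ⟨ws, h0, h1, h2⟩
  have hIc : IsCompact I := by
    rw [hIW]
    exact hWc.image (continuous_apply 0)
  have hIK : I ⊆ ⋃ j, K j := by
    intro w hw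
    obtain ⟨ws, h0, h1, h2⟩ := orb w hw
    exact Set.mem_iUnion.2 ⟨g w 0, h0 ▸ h1 0⟩
  have hgc : ContinuousOn g I := by
    rw [continuousOn_pi]
    intro i
    rw [continuousOn_iff_isClosed]
    intro t _
    have hcl : IsClosed (⋃ j ∈ t, K j) :=
      t.toFinite.isClosed_biUnion fun j _ => (hKc j).isClosed
    refine ⟨(fun ws : ℤ → Z => ws 0) '' (W ∩ (fun ws : ℤ → Z => ws i) ⁻¹' (⋃ j ∈ t, K j)),
      ((hWc.inter_right (hcl.preimage (continuous_apply i))).image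
        (continuous_apply 0)).isClosed, ?_⟩
    ext w
    constructor
    · rintro ⟨ht, hw⟩
      obtain ⟨ws, h0, h1, h2⟩ := orb w hw
      refine ⟨⟨ws, ⟨⟨fun i => Set.mem_iUnion.2 ⟨_, h1 i⟩, fun i => (h2 i).symm⟩, ?_⟩, h0⟩, hw⟩
      exact Set.mem_biUnion (x := g w i) ht (h1 i)
    · rintro ⟨⟨ws, ⟨⟨h1, h2⟩, h3⟩, h0⟩, hw⟩
      refine ⟨?_, hw⟩
      obtain ⟨j, hj, hwj⟩ := Set.mem_iUnion₂.1 h3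
      have := hg w hw ws h0 h1 h2 i
      have e : g w i = j := by
        by_contra hne
        exact Set.disjoint_left.1 (hKd hne) this hwj
      change g w i ∈ t
      rw [e]
      exact hj
  have hPI : P ⊆ I := by
    rw [hP]
    exact fun w h => h.1
  have hΛI : Λ ⊆ I := by
    rw [hΛ]
    exact closure_minimal hPI hIc.isClosed
  have hPΛ : P ⊆ Λ := by
    rw [hΛ]
    exact subset_closure
  have hΛc : IsCompact Λ := hIc.of_isClosed_subset (hΛ ▸ isClosed_closure) hΛI
  have hψΛ : ContinuousOn ψ Λ := hcont.mono (hΛI.trans hIK)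
  have hψP : ∀ w ∈ P, ψ w ∈ P := by
    intro w hw
    rw [hP] at hw ⊢
    obtain ⟨h, k, hk, hkw⟩ := hw
    refine ⟨(shift w h).1, k, hk, ?_⟩
    rw [← Function.iterate_succ_apply, Function.iterate_succ_apply', hkw]
  have hψPn : ∀ n : ℕ, ∀ w ∈ P, ψ^[n] w ∈ P := by
    intro n
    induction n with
    | zero => exact fun w h => h
    | succ n ih =>
      intro w hw
      rw [Function.iterate_succ_apply]
      exact ih _ (hψP w hw)
  have hperiodic : ∀ (s : ℤ → Fin m) (k : ℕ), 1 ≤ k → (∀ i, s (i + (k : ℤ)) = s i) →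
      ∃ w ∈ Λ, g w = s ∧ ψ^[k] w = w := by
    intro s k hk hs
    obtain ⟨ws, h1, h2, h3⟩ := hper s k hk hs
    obtain ⟨hw, hgw⟩ := key ws s h1 h2
    have hit : ∀ n : ℕ, ψ^[n] (ws 0) = ws n := by
      intro n
      induction n with
      | zero => rfl
      | succ n ih =>
        rw [Function.iterate_succ_apply', ih, ← h2]
        push_cast
        rfl
    have hk0 : ψ^[k] (ws 0) = ws 0 := by
      rw [hit, ← h3 0, zero_add]
    refine ⟨ws 0, hPΛ ?_, hgw, hk0⟩
    rw [hP]
    exact ⟨hw, k, hk, hk0⟩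
  refine ⟨hΛc, ?_, hgc.mono hΛI, ?_, fun w hw => (shift w (hΛI hw)).2,
    fun w hw => hΛ ▸ hw, hperiodic⟩
  · apply Set.Subset.antisymm
    · have h1 : ψ '' closure P ⊆ closure (ψ '' P) := by
        apply ContinuousOn.image_closure
        rw [← hΛ]
        exact hψΛ
      rw [hΛ]
      refine h1.trans (closure_mono ?_)
      rintro _ ⟨w, hw, rfl⟩
      exact hψP w hw
    · have hcl : IsClosed (ψ '' Λ) := (hΛc.image_of_continuousOn hψΛ).isClosed
      conv_lhs => rw [hΛ]
      refine closure_minimal ?_ hcl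
      intro w hw
      have hw' := hw
      rw [hP] at hw'
      obtain ⟨h, k, hk, hkw⟩ := hw'
      refine ⟨ψ^[k-1] w, hPΛ (hψPn _ w hw), ?_⟩
      rw [← Function.iterate_succ_apply' ψ, Nat.succ_eq_add_one, Nat.sub_add_cancel hk, hkw]
  · have hcl : IsClosed (g '' Λ) := (hΛc.image_of_continuousOn (hgc.mono hΛI)).isClosed
    rw [Set.eq_univ_iff_forall]
    intro s
    let a : ℕ → ℤ → Fin m := fun n i => s ((i + n) % (2 * n + 1) - n)
    have ha : Filter.Tendsto a Filter.atTop (nhds s) := by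
      rw [tendsto_pi_nhds]
      intro i
      refine tendsto_const_nhds.congr' ?_
      filter_upwards [Filter.eventually_ge_atTop i.natAbs] with n hn
      have : (i + n) % (2 * n + 1) = i + (n : ℤ) := Int.emod_eq_of_lt (by omega) (by omega)
      simp only [a, this, add_sub_cancel_right]
    refine hcl.mem_of_tendsto ha (Filter.Eventually.of_forall fun n => ?_)
    obtain ⟨w, hw, hgw, -⟩ := hperiodic (a n) (2 * n + 1) (by omega) (by
      intro i
      simp only [a]
      congr 2
      push_cast
      rw [show i + (2 * (n : ℤ) + 1) + n = (i + n) + (2 * n + 1) by ring, Int.add_emod_right])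
    exact ⟨w, hw, hgw⟩
end

section
/- Let (Z, d_Z) be a metric space and let ψ : D_ψ ⊆ Z → Z induce chaotic dynamics on m ≥ 2 symbols in a set D ⊆ D_ψ relative to pairwise disjoint nonempty compact sets K_1, …, K_m, with ψ continuous and injective on K := K_1 ∪ ⋯ ∪ K_m. Let I := { w ∈ K : there exists a two-sided sequence (w_i)_{i∈ℤ} in K with w_0 = w and ψ(w_i) = w_{i+1} for all i }. Then the topological entropy of the restriction ψ|_I : I → I satisfies h_top(ψ|_I) ≥ log m. -/
open Set Filter Topology in
theorem cde_sep {Z : Type*} [MetricSpace Z] {m : ℕ} (K : Fin m → Set Z)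
    (hKc : ∀ j, IsCompact (K j))
    (hKd : Pairwise fun i j => Disjoint (K i) (K j)) :
    ∃ δ : ℝ, 0 < δ ∧ ∀ i j, ∀ x ∈ K i, ∀ y ∈ K j, dist x y < δ → i = j := by
  have h : ∀ i j, ∀ᶠ δ in 𝓝[>] (0:ℝ), ∀ x ∈ K i, ∀ y ∈ K j, dist x y < δ → i = j := by
    intro i j
    by_cases hij : i = j
    · exact Eventually.of_forall fun _ _ _ _ _ _ => hij
    · obtain ⟨r, hr, h⟩ := Metric.exists_pos_forall_lt_edist (hKc i) (hKc j).isClosed (hKd hij)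
      have hr' : (0:ℝ) < r := hr
      filter_upwards [Ioo_mem_nhdsGT hr'] with δ hδ x hx y hy hxy
      have h1 := h x hx y hy
      rw [edist_nndist, ENNReal.coe_lt_coe, ← NNReal.coe_lt_coe, coe_nndist] at h1
      linarith [hδ.2]
  have h2 := eventually_all.2 fun i => eventually_all.2 (h i)
  obtain ⟨δ, h3, h4⟩ := (h2.and self_mem_nhdsWithin).exists
  exact ⟨δ, h4, h3⟩

theorem cde_card {Z : Type*} [MetricSpace Z]
    (ψ : Z → Z) (m : ℕ) (hm : 2 ≤ m) (K : Fin m → Set Z)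
    (hchaos : ∀ s : ℤ → Fin m, ∃ w : ℤ → Z,
      (∀ i, w i ∈ K (s i)) ∧ ∀ i, w (i + 1) = ψ (w i))
    (I : Set Z)
    (hI : I = {w : Z | ∃ ws : ℤ → Z, ws 0 = w ∧ (∀ i, ws i ∈ ⋃ j, K j) ∧
      ∀ i, ψ (ws i) = ws (i + 1)})
    (δ : ℝ) (hpos : 0 < δ) (hδ : ∀ i j, ∀ x ∈ K i, ∀ y ∈ K j, dist x y < δ → i = j) (n : ℕ) :
    ((m ^ n : ℕ) : ℕ∞) ≤ Dynamics.netMaxcard ψ I {p : Z × Z | dist p.1 p.2 < δ / 2} n := by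
  classical
  choose w hw1 hw2 using hchaos
  let e : (Fin n → Fin m) → (ℤ → Fin m) := fun a i =>
    if h : i.toNat < n then a ⟨i.toNat, h⟩ else ⟨0, by omega⟩
  let f : (Fin n → Fin m) → Z := fun a => w (e a) 0
  have hit : ∀ a (k : ℕ), ψ^[k] (f a) = w (e a) k := by
    intro a k
    induction k with
    | zero => rfl
    | succ k ih => rw [Function.iterate_succ_apply', ih, ← hw2]; push_cast; rfl
  have key : ∀ a b, (∀ k < n, dist (ψ^[k] (f a)) (ψ^[k] (f b)) < δ) → a = b := by
    intro a b h
    funext k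
    have h1 := h k k.2
    rw [hit, hit] at h1
    have h2 := hδ _ _ _ (hw1 (e a) k) _ (hw1 (e b) k) h1
    simpa [e] using h2
  have hball : ∀ a b z, z ∈ UniformSpace.ball (f a)
        (Dynamics.dynEntourage ψ {p : Z × Z | dist p.1 p.2 < δ / 2} n) →
      z ∈ UniformSpace.ball (f b)
        (Dynamics.dynEntourage ψ {p : Z × Z | dist p.1 p.2 < δ / 2} n) → a = b := by
    intro a b z ha hb
    rw [Dynamics.mem_ball_dynEntourage] at ha hb
    apply key
    intro k hk
    have h1 : dist (ψ^[k] (f a)) (ψ^[k] z) < δ / 2 := ha k hk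
    have h2 : dist (ψ^[k] (f b)) (ψ^[k] z) < δ / 2 := hb k hk
    linarith [dist_triangle_right (ψ^[k] (f a)) (ψ^[k] (f b)) (ψ^[k] z)]
  have hinj : Function.Injective f := by
    intro a b hab
    apply key
    intro k _
    rw [hab, dist_self]
    exact hpos
  have hnet : Dynamics.IsDynNetIn ψ I {p : Z × Z | dist p.1 p.2 < δ / 2} n
      ((Finset.univ.image f : Finset Z) : Set Z) := by
    constructor
    · intro x hx
      simp only [Finset.coe_image, Finset.coe_univ, Set.image_univ, Set.mem_range] at hx
      obtain ⟨a, rfl⟩ := hx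
      rw [hI]
      exact ⟨w (e a), rfl, fun i => Set.mem_iUnion.2 ⟨_, hw1 _ i⟩, fun i => (hw2 _ i).symm⟩
    · intro x hx y hy hxy
      simp only [Finset.coe_image, Finset.coe_univ, Set.image_univ, Set.mem_range] at hx hy
      obtain ⟨a, rfl⟩ := hx
      obtain ⟨b, rfl⟩ := hy
      exact Set.disjoint_left.2 fun z h1 h2 => hxy (congrArg f (hball a b z h1 h2))
  have h := hnet.card_le_netMaxcard
  rw [Finset.card_image_of_injective _ hinj] at h
  simpa using h


/-- if `ψ` induces chaotic dynamics on `m ≥ 2` symbols in `D` relatively to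
the pairwise disjoint nonempty compact sets `K j`, and `ψ` is continuous and injective
on `K = ⋃ j, K j`, then the topological entropy of `ψ` restricted to the maximal
two-sided invariant set `I ⊆ K` is at least `log m`. -/
theorem chaotic_dynamics_entropy {Z : Type*} [MetricSpace Z]
    (ψ : Z → Z) (D : Set Z) (m : ℕ) (hm : 2 ≤ m)
    (K : Fin m → Set Z)
    (hKD : ∀ j, K j ⊆ D)
    (hKne : ∀ j, (K j).Nonempty) (hKc : ∀ j, IsCompact (K j))
    (hKd : Pairwise fun i j => Disjoint (K i) (K j))
    (hchaos : ∀ s : ℤ → Fin m, ∃ w : ℤ → Z,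
      (∀ i, w i ∈ K (s i)) ∧ ∀ i, w (i + 1) = ψ (w i))
    (hper : ∀ (s : ℤ → Fin m) (k : ℕ), 1 ≤ k → (∀ i, s (i + (k : ℤ)) = s i) →
      ∃ w : ℤ → Z, (∀ i, w i ∈ K (s i)) ∧ (∀ i, w (i + 1) = ψ (w i)) ∧
        ∀ i, w (i + (k : ℤ)) = w i)
    (hcont : ContinuousOn ψ (⋃ j, K j)) (hinj : Set.InjOn ψ (⋃ j, K j))
    (I : Set Z)
    (hI : I = {w : Z | ∃ ws : ℤ → Z, ws 0 = w ∧ (∀ i, ws i ∈ ⋃ j, K j) ∧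
      ∀ i, ψ (ws i) = ws (i + 1)}) :
    (Real.log m : EReal) ≤ Dynamics.coverEntropy ψ I := by
  obtain ⟨δ, hpos, hδ⟩ := cde_sep K hKc hKd
  have hU : {p : Z × Z | dist p.1 p.2 < δ / 2} ∈ uniformity Z :=
    Metric.dist_mem_uniformity (half_pos hpos)
  have hcard := cde_card ψ m hm K hchaos I hI δ hpos hδ
  refine le_trans ?_ ((Dynamics.netEntropyEntourage_le_coverEntropyEntourage ψ I).trans
    (Dynamics.coverEntropyEntourage_le_coverEntropy ψ I hU))
  have h1 : ExpGrowth.expGrowthSup (fun n : ℕ => ((m : ENNReal)) ^ n) ≤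
      Dynamics.netEntropyEntourage ψ I {p : Z × Z | dist p.1 p.2 < δ / 2} := by
    apply ExpGrowth.expGrowthSup_monotone
    intro n
    have := ENat.toENNReal_mono (hcard n)
    simpa using this
  refine le_trans (le_of_eq ?_) h1
  rw [ExpGrowth.expGrowthSup_pow]
  have h2 : (m : ENNReal) = ENNReal.ofReal (m : ℝ) := by simp
  rw [h2, ENNReal.log_ofReal_of_pos (by positivity)]
end

section
/- Let a, b, c, d > 0 and T > 0. Suppose x, y : ℝ → ℝ are differentiable, T-periodic, satisfy x(t) > 0, y(t) > 0, and x'(t) = x(t)(a − b y(t)), y'(t) = y(t)(−c + d x(t)) for all t ∈ ℝ. Then the averages of the solution over one period equal the coordinates of the equilibrium P_0: (1/T)∫_0^T x(t) dt = c/d and (1/T)∫_0^T y(t) dt = a/b. -/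
theorem average_aux (p q T : ℝ) (hq : q ≠ 0) (hT : 0 < T) (u v : ℝ → ℝ)
    (hu : ∀ t, 0 < u t) (hper : ∀ t, u (t + T) = u t) (hv : Continuous v)
    (h : ∀ t, HasDerivAt u (u t * (p + q * v t)) t) :
    (1 / T) * (∫ t in (0 : ℝ)..T, v t) = -p / q := by
  have hlog : ∀ t, HasDerivAt (fun s => Real.log (u s)) (p + q * v t) t := by
    intro t
    have h1 := (h t).log (hu t).ne'
    rwa [mul_div_cancel_left₀ _ (hu t).ne'] at h1
  have h1 : ∫ t in (0 : ℝ)..T, (p + q * v t) = Real.log (u T) - Real.log (u 0) :=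
    intervalIntegral.integral_eq_sub_of_hasDerivAt (fun t _ => hlog t)
      ((by fun_prop : Continuous fun t => p + q * v t).intervalIntegrable _ _)
  have h0 := hper 0
  rw [zero_add] at h0
  rw [h0, sub_self, intervalIntegral.integral_add (by simp)
    ((by fun_prop : Continuous fun t => q * v t).intervalIntegrable _ _),
    intervalIntegral.integral_const, intervalIntegral.integral_const_mul, smul_eq_mul] at h1
  field_simp
  linarith

/-- Volterra's average principle: for any positive `T`-periodic solution of
`x' = x(a − b y)`, `y' = y(−c + d x)`, the averages over one period of `x` and `y` equal
the coordinates `c/d` and `a/b` of the equilibrium. -/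
theorem volterra_average_principle (a b c d T : ℝ)
    (ha : 0 < a) (hb : 0 < b) (hc : 0 < c) (hd : 0 < d) (hT : 0 < T)
    (x y : ℝ → ℝ)
    (hxpos : ∀ t, 0 < x t) (hypos : ∀ t, 0 < y t)
    (hxper : ∀ t, x (t + T) = x t) (hyper : ∀ t, y (t + T) = y t)
    (hx : ∀ t, HasDerivAt x (x t * (a - b * y t)) t)
    (hy : ∀ t, HasDerivAt y (y t * (-c + d * x t)) t) :
    (1 / T) * ∫ t in (0 : ℝ)..T, x t = c / d ∧
    (1 / T) * ∫ t in (0 : ℝ)..T, y t = a / b := by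
  have hxc : Continuous x := continuous_iff_continuousAt.2 fun t => (hx t).continuousAt
  have hyc : Continuous y := continuous_iff_continuousAt.2 fun t => (hy t).continuousAt
  constructor
  · have := average_aux (-c) d T hd.ne' hT y x hypos hyper hxc hy
    rwa [neg_neg] at this
  · have := average_aux a (-b) T (neg_ne_zero.2 hb.ne') hT x y hxpos hxper hyc (fun t => by
      have h := hx t
      rwa [sub_eq_add_neg, ← neg_mul] at h)
    rwa [neg_div_neg_eq] at this
end

section
/- Let f : [0,1] → ℝ be continuous, let m ≥ 1 be an integer, and let a_1 ≤ b_1 < a_2 ≤ b_2 < ⋯ < a_m ≤ b_m be real numbers with f(1) ≤ a_1 and f(0) ≥ b_m. Then there exist m pairwise disjoint closed subintervals J_1, …, J_m of [0,1] and, for each i, points t_i', t_i'' ∈ J_i which are the endpoints of J_i, such that f(t_i') = a_i, f(t_i'') = b_i, and f(s) ∈ [a_i, b_i] for all s ∈ J_i. -/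
theorem single_crossing (f : ℝ → ℝ) (hf : ContinuousOn f (Set.Icc 0 1)) (A B : ℝ)
    (hAB : A ≤ B) (h1 : f 1 ≤ A) (h0 : B ≤ f 0) :
    ∃ p q : ℝ, 0 ≤ p ∧ p ≤ q ∧ q ≤ 1 ∧ f p = B ∧ f q = A ∧
      ∀ s ∈ Set.Icc p q, f s ∈ Set.Icc A B := by
  have key : ∀ u v c : ℝ, 0 ≤ u → u ≤ v → v ≤ 1 → f v ≤ c → c ≤ f u →
      ∃ t ∈ Set.Icc u v, f t = c := by
    intro u v c hu huv hv hvc hcu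
    exact intermediate_value_Icc' huv (hf.mono (Set.Icc_subset_Icc hu hv)) ⟨hvc, hcu⟩
  have comp : ∀ v c : ℝ, v ≤ 1 → IsCompact (Set.Icc 0 v ∩ f ⁻¹' {c}) := by
    intro v c hv
    exact isCompact_Icc.of_isClosed_subset
      ((hf.mono (Set.Icc_subset_Icc le_rfl hv)).preimage_isClosed_of_isClosed
        isClosed_Icc isClosed_singleton) Set.inter_subset_left
  obtain ⟨x, hx, hxA⟩ := key 0 1 A le_rfl zero_le_one le_rfl h1 (hAB.trans h0)
  obtain ⟨q, ⟨⟨hq0, hq1⟩, hqA⟩, hqmin⟩ := (comp 1 A le_rfl).exists_isLeast ⟨x, hx, hxA⟩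
  have hqA' : f q = A := hqA
  obtain ⟨y, hy, hyB⟩ := key 0 q B le_rfl hq0 hq1 (hqA'.le.trans hAB) h0
  obtain ⟨p, ⟨⟨hp0, hpq⟩, hpB⟩, hpmax⟩ := (comp q B hq1).exists_isGreatest ⟨y, hy, hyB⟩
  have hpB' : f p = B := hpB
  refine ⟨p, q, hp0, hpq, hq1, hpB', hqA', ?_⟩
  rintro s ⟨hps, hsq⟩
  constructor
  · by_contra! h
    obtain ⟨t, ht, htA⟩ := key 0 s A le_rfl (hp0.trans hps) (hsq.trans hq1) h.le (hAB.trans h0)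
    have hqt : q ≤ t := hqmin ⟨⟨ht.1, ht.2.trans (hsq.trans hq1)⟩, htA⟩
    have : s = q := le_antisymm hsq (hqt.trans ht.2)
    rw [this] at h
    linarith
  · by_contra! h
    obtain ⟨t, ht, htB⟩ := key s q B (hp0.trans hps) hsq hq1 (hqA'.le.trans hAB) h.le
    have htp : t ≤ p := hpmax ⟨⟨(hp0.trans hps).trans ht.1, ht.2⟩, htB⟩
    have : s = p := le_antisymm (ht.1.trans htp) hps
    rw [this] at h
    linarith

/-- Bolzano-type multi-crossing lemma. If `f : [0,1] → ℝ` is continuous,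
`a 1 ≤ b 1 < a 2 ≤ b 2 < ⋯ < a m ≤ b m`, `f(1) ≤ a 1` and `f(0) ≥ b m`, then there are
`m` pairwise disjoint closed subintervals `J i = uIcc (t' i) (t'' i)` of `[0,1]`, with
endpoints `t' i`, `t'' i`, on which `f` stays in `[a i, b i]`, with `f (t' i) = a i` and
`f (t'' i) = b i`. -/
theorem bolzano_multi_crossing (f : ℝ → ℝ) (hf : ContinuousOn f (Set.Icc 0 1))
    (m : ℕ) (hm : 1 ≤ m) (a b : Fin m → ℝ)
    (hab : ∀ i, a i ≤ b i)
    (hord : ∀ i j : Fin m, i < j → b i < a j)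
    (hf1 : f 1 ≤ a ⟨0, by omega⟩)
    (hf0 : b ⟨m - 1, by omega⟩ ≤ f 0) :
    ∃ t' t'' : Fin m → ℝ,
      (∀ i, t' i ∈ Set.Icc (0 : ℝ) 1 ∧ t'' i ∈ Set.Icc (0 : ℝ) 1 ∧
        f (t' i) = a i ∧ f (t'' i) = b i ∧
        Set.uIcc (t' i) (t'' i) ⊆ Set.Icc (0 : ℝ) 1 ∧
        ∀ s ∈ Set.uIcc (t' i) (t'' i), f s ∈ Set.Icc (a i) (b i)) ∧
      Pairwise fun i j : Fin m =>
        Disjoint (Set.uIcc (t' i) (t'' i)) (Set.uIcc (t' j) (t'' j)) := by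
  have mono_b : ∀ i j : Fin m, i ≤ j → a i ≤ a j ∧ b i ≤ b j := by
    intro i j hij
    rcases hij.eq_or_lt with rfl | h
    · exact ⟨le_rfl, le_rfl⟩
    · have := hord i j h
      have := hab i
      have := hab j
      constructor <;> linarith
  have H : ∀ i, ∃ p q : ℝ, 0 ≤ p ∧ p ≤ q ∧ q ≤ 1 ∧ f p = b i ∧ f q = a i ∧
      ∀ s ∈ Set.Icc p q, f s ∈ Set.Icc (a i) (b i) := by
    intro i
    refine single_crossing f hf (a i) (b i) (hab i) (hf1.trans (mono_b _ i ?_).1)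
      ((mono_b i _ ?_).2.trans hf0)
    · rw [Fin.le_def]
      exact Nat.zero_le _
    · rw [Fin.le_def]
      have := i.2
      show (i : ℕ) ≤ m - 1
      omega
  choose p q hp hpq hq hfp hfq hs using H
  have hu : ∀ i, Set.uIcc (q i) (p i) = Set.Icc (p i) (q i) := fun i =>
    Set.uIcc_of_ge (hpq i)
  refine ⟨q, p, fun i => ⟨⟨(hp i).trans (hpq i), hq i⟩, ⟨hp i, (hpq i).trans (hq i)⟩, hfq i,
    hfp i, ?_, ?_⟩, ?_⟩
  · rw [hu]
    exact Set.Icc_subset_Icc (hp i) (hq i)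
  · rw [hu]
    exact hs i
  · intro i j hij
    show Disjoint (Set.uIcc (q i) (p i)) (Set.uIcc (q j) (p j))
    rw [hu, hu, Set.disjoint_left]
    intro s hsi hsj
    have h1 := hs i s hsi
    have h2 := hs j s hsj
    rcases lt_or_gt_of_ne hij with h | h
    · linarith [hord i j h, h1.2, h2.1]
    · linarith [hord j i h, h2.2, h1.1]
end
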